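/- Suppose there exist constants c > 0 and R > 0 such that x·∇V(x) ≥ c|x| for all |x| ≥ R, and suppose that for every R' > 0 the measure μ satisfies the local Poincaré inequality on B(0,R') with some constant κ_{R'}. Then μ satisfies a Poincaré inequality: there exists C > 0 such that for every smooth compactly supported function f, Var_μ(f) ≤ C ∫ |∇f|² dμ. -/

import Mathlib

open MeasureTheory Real Set
open scoped ENNReal RealInnerProductSpace

noncomputable section

abbrev En (n : ℕ) := EuclideanSpace ℝ (Fin n)

/-- The Laplacian on `ℝⁿ`: sum of second partial derivatives. -/
def lapl {n : ℕ} (g : En n → ℝ) (x : En n) : ℝ :=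
  ∑ i : Fin n,
    fderiv ℝ (fun y => fderiv ℝ g y (EuclideanSpace.single i 1)) x (EuclideanSpace.single i 1)

/-- The diffusion operator `L g = Δ g - ∇V · ∇g`. -/
def Lop {n : ℕ} (V g : En n → ℝ) (x : En n) : ℝ :=
  lapl g x - ⟪gradient V x, gradient g x⟫

/-- The Boltzmann measure `dμ = e^{-V}/Z dx`. -/
def boltz {n : ℕ} (V : En n → ℝ) : Measure (En n) :=
  (volume : Measure (En n)).withDensity
    (fun x => ENNReal.ofReal (Real.exp (-V x) / ∫ y, Real.exp (-V y)))

section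

variable {n : ℕ} {V : En n → ℝ}

theorem norm_gradient (f : En n → ℝ) (x : En n) : ‖gradient f x‖ = ‖fderiv ℝ f x‖ := by
  simp [gradient]

theorem inner_self_gradient (f : En n → ℝ) (x : En n) :
    ⟪x, gradient f x⟫ = fderiv ℝ f x x := by
  rw [real_inner_comm, gradient, InnerProductSpace.toDual_symm_apply]

theorem isProbabilityMeasure_boltz
    (hVint : Integrable (fun x => Real.exp (-V x))) : IsProbabilityMeasure (boltz V) := by
  have hZ := integral_exp_pos hVint
  constructor
  rw [boltz, withDensity_apply _ MeasurableSet.univ, Measure.restrict_univ,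
    ← ofReal_integral_eq_lintegral_ofReal (hVint.div_const _)
      (Filter.Eventually.of_forall fun x => by positivity), integral_div, div_self hZ.ne',
    ENNReal.ofReal_one]

theorem integral_boltz (hV : Continuous V) (f : En n → ℝ) :
    ∫ x, f x ∂(boltz V) = (∫ y, Real.exp (-V y))⁻¹ * ∫ x, f x * Real.exp (-V x) := by
  have hZ : 0 ≤ ∫ y, Real.exp (-V y) := integral_nonneg fun _ => (Real.exp_pos _).le
  rw [boltz, integral_withDensity_eq_integral_toReal_smul (by fun_prop)
    (Filter.Eventually.of_forall fun _ => ENNReal.ofReal_lt_top), ← integral_const_mul]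
  refine integral_congr_ae (Filter.Eventually.of_forall fun x => ?_)
  have : 0 ≤ Real.exp (-V x) / ∫ y, Real.exp (-V y) := by positivity
  simp only [ENNReal.toReal_ofReal this, smul_eq_mul]
  ring

/-- Integration by parts of the dilation field `x ↦ x` against the Boltzmann measure. -/
theorem integral_mul_fderiv_self_boltz (hV : ContDiff ℝ 1 V) {h : En n → ℝ}
    (hh : ContDiff ℝ 1 h) (hc : HasCompactSupport h) :
    ∫ x, h x * fderiv ℝ V x x ∂(boltz V) = ∫ x, (n * h x + fderiv ℝ h x x) ∂(boltz V) := by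
  rw [integral_boltz hV.continuous, integral_boltz hV.continuous]
  congr 1
  have hVd : Differentiable ℝ V := hV.differentiable one_ne_zero
  have hhd : Differentiable ℝ h := hh.differentiable one_ne_zero
  have hVc : Continuous (fderiv ℝ V) := hV.continuous_fderiv one_ne_zero
  have hhc : Continuous (fderiv ℝ h) := hh.continuous_fderiv one_ne_zero
  have hV0 := hV.continuous
  have hh0 := hh.continuous
  let e : Fin n → En n := fun i => EuclideanSpace.single i 1
  have hx (x : En n) : ∑ i, x i • e i = x := by
    ext j
    simp [e, Finset.sum_apply, Pi.single_apply]
  have hD (x : En n) (L : En n →L[ℝ] ℝ) : L x = ∑ i, x i * L (e i) := by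
    conv_lhs => rw [← hx x]
    simp
  have hexp (x : En n) (i : Fin n) : fderiv ℝ (fun y => Real.exp (-V y)) x (e i)
      = -(Real.exp (-V x) * fderiv ℝ V x (e i)) := by
    have h1 : fderiv ℝ (fun y => Real.exp (-V y)) x = _ := (hVd x).hasFDerivAt.neg.exp.fderiv
    rw [h1]
    simp
  have hprod (x : En n) (i : Fin n) : fderiv ℝ (fun y : En n => y i * h y) x (e i)
      = h x + x i * fderiv ℝ h x (e i) := by
    have h1 : HasFDerivAt (fun y : En n => y i) (EuclideanSpace.proj i : En n →L[ℝ] ℝ) x :=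
      (EuclideanSpace.proj i : En n →L[ℝ] ℝ).hasFDerivAt
    have h2 : fderiv ℝ (fun y : En n => y i * h y) x = _ := (h1.mul (hhd x).hasFDerivAt).fderiv
    rw [h2]
    simp [e]
    ring
  have hcoord (i : Fin n) : Continuous fun x : En n => x i := by fun_prop
  have hc' := hc.fderiv (𝕜 := ℝ)
  have i1 (i : Fin n) : Integrable fun x : En n =>
      (h x + x i * fderiv ℝ h x (e i)) * Real.exp (-V x) := by
    refine Continuous.integrable_of_hasCompactSupport (by fun_prop) ?_
    refine HasCompactSupport.mul_right (hc.add (HasCompactSupport.mul_left ?_))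
    exact hc'.comp_left (g := fun L : En n →L[ℝ] ℝ => L (e i)) (by simp)
  have i2 (i : Fin n) : Integrable fun x : En n =>
      x i * h x * (Real.exp (-V x) * fderiv ℝ V x (e i)) := by
    refine Continuous.integrable_of_hasCompactSupport (by fun_prop) ?_
    exact HasCompactSupport.mul_right hc.mul_left
  have i3 (i : Fin n) : Integrable fun x : En n => x i * h x * Real.exp (-V x) := by
    refine Continuous.integrable_of_hasCompactSupport (by fun_prop) ?_
    exact HasCompactSupport.mul_right hc.mul_left
  have key (i : Fin n) : ∫ x : En n, x i * h x * (Real.exp (-V x) * fderiv ℝ V x (e i))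
      = ∫ x : En n, (h x + x i * fderiv ℝ h x (e i)) * Real.exp (-V x) := by
    have := integral_mul_fderiv_eq_neg_fderiv_mul_of_integrable (μ := (volume : Measure (En n)))
      (f := fun y : En n => y i * h y) (g := fun y => Real.exp (-V y)) (v := e i)
      (by simpa only [hprod] using i1 i)
      (by simp only [hexp, mul_neg]; exact (i2 i).neg) (i3 i)
      (fun x _ => by fun_prop) (fun x _ => by fun_prop)
    simp only [hprod, hexp, mul_neg, integral_neg, neg_inj] at this
    exact this
  calc ∫ x, h x * fderiv ℝ V x x * Real.exp (-V x)
      = ∫ x, ∑ i, x i * h x * (Real.exp (-V x) * fderiv ℝ V x (e i)) := by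
        refine integral_congr_ae (Filter.Eventually.of_forall fun x => ?_)
        simp only [hD x (fderiv ℝ V x), Finset.mul_sum, Finset.sum_mul]
        exact Finset.sum_congr rfl fun i _ => by ring
    _ = ∫ x, ∑ i, (h x + x i * fderiv ℝ h x (e i)) * Real.exp (-V x) := by
        rw [integral_finsetSum _ fun i _ => i2 i, integral_finsetSum _ fun i _ => i1 i]
        exact Finset.sum_congr rfl fun i _ => key i
    _ = ∫ x, (n * h x + fderiv ℝ h x x) * Real.exp (-V x) := by
        refine integral_congr_ae (Filter.Eventually.of_forall fun x => ?_)
        simp [hD x (fderiv ℝ h x), ← Finset.sum_mul, Finset.sum_add_distrib]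

/-- The weight which turns the dilation field into a bounded field. -/
def radialWeight (x : En n) : ℝ := (√(1 + ‖x‖ ^ 2))⁻¹

theorem radialWeight_pos (x : En n) : 0 < radialWeight x := by
  unfold radialWeight
  positivity

theorem radialWeight_mul_norm_le (x : En n) : radialWeight x * ‖x‖ ≤ 1 := by
  rw [radialWeight, inv_mul_le_iff₀ (by positivity), mul_one]
  exact Real.le_sqrt_of_sq_le (by linarith)

theorem one_le_radialWeight_mul (x : En n) : 1 ≤ radialWeight x * (1 + ‖x‖) := by
  rw [radialWeight, le_inv_mul_iff₀ (by positivity), mul_one]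
  refine Real.sqrt_le_iff.2 ⟨by positivity, ?_⟩
  nlinarith [norm_nonneg x]

theorem contDiff_radialWeight {k : WithTop ℕ∞} : ContDiff ℝ k (radialWeight (n := n)) := by
  have h (x : En n) : 1 + ‖x‖ ^ 2 ≠ 0 := by positivity
  exact ((contDiff_const.add (contDiff_norm_sq ℝ)).sqrt h).inv fun x => by positivity

theorem fderiv_radialWeight_self_nonpos (x : En n) : fderiv ℝ radialWeight x x ≤ 0 := by
  have hs : 0 < 1 + ‖x‖ ^ 2 := by positivity
  have h1 : HasFDerivAt (fun y : En n => 1 + ‖y‖ ^ 2) (2 • innerSL ℝ x) x :=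
    (hasStrictFDerivAt_norm_sq x).hasFDerivAt.const_add 1
  have h2 := ((Real.hasDerivAt_sqrt hs.ne').inv (Real.sqrt_pos.2 hs).ne').comp_hasFDerivAt x h1
  have h3 : fderiv ℝ radialWeight x = _ := h2.fderiv
  have h4 : (2 • innerSL ℝ x) x = 2 * ‖x‖ ^ 2 := by
    simp
  rw [h3, FunLike.coe_smul, Pi.smul_apply, h4, smul_eq_mul, neg_div, neg_mul,
    Left.neg_nonpos_iff]
  positivity

theorem fderiv_radialWeight_mul_sq_self_le {g : En n → ℝ} {x : En n}
    (hg : DifferentiableAt ℝ g x) :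
    fderiv ℝ (fun y => radialWeight y * g y ^ 2) x x ≤ 2 * (|g x| * ‖fderiv ℝ g x‖) := by
  have hw : HasFDerivAt radialWeight (fderiv ℝ radialWeight x) x :=
    ((contDiff_radialWeight (k := 1)).differentiable one_ne_zero x).hasFDerivAt
  have h : fderiv ℝ (fun y => radialWeight y * g y ^ 2) x = _ :=
    (hw.mul (hg.hasFDerivAt.pow 2)).fderiv
  have h1 : g x ^ 2 * fderiv ℝ radialWeight x x ≤ 0 :=
    mul_nonpos_of_nonneg_of_nonpos (sq_nonneg _) (fderiv_radialWeight_self_nonpos x)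
  have h2 : radialWeight x * (g x * fderiv ℝ g x x) ≤ |g x| * ‖fderiv ℝ g x‖ := by
    have h3 : |fderiv ℝ g x x| ≤ ‖fderiv ℝ g x‖ * ‖x‖ := (fderiv ℝ g x).le_opNorm x
    calc radialWeight x * (g x * fderiv ℝ g x x)
        ≤ radialWeight x * (|g x| * (‖fderiv ℝ g x‖ * ‖x‖)) := by
          refine mul_le_mul_of_nonneg_left ?_ (radialWeight_pos x).le
          refine (le_abs_self _).trans ?_
          rw [abs_mul]
          gcongr
      _ = |g x| * ‖fderiv ℝ g x‖ * (radialWeight x * ‖x‖) := by ring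
      _ ≤ |g x| * ‖fderiv ℝ g x‖ * 1 := by
          gcongr
          exact radialWeight_mul_norm_le x
      _ = _ := mul_one _
  rw [h]
  simp
  linarith

/-- A radial drift condition controls the mass of `g ^ 2` by its mass on a ball and the Dirichlet
form. -/
theorem exists_integral_sq_le_of_drift (hV : ContDiff ℝ 1 V)
    (hVint : Integrable (fun x => Real.exp (-V x))) {c R : ℝ} (hc : 0 < c)
    (hdrift : ∀ x : En n, R ≤ ‖x‖ → c * ‖x‖ ≤ fderiv ℝ V x x) :
    ∃ R₀ A D : ℝ, 0 < R₀ ∧ 0 ≤ A ∧ 0 ≤ D ∧ ∀ g : En n → ℝ, ContDiff ℝ 1 g → HasCompactSupport g →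
      ∫ x, g x ^ 2 ∂(boltz V) ≤ A * ∫ x in {x : En n | ‖x‖ ≤ R₀}, g x ^ 2 ∂(boltz V)
        + D * ∫ x, ‖fderiv ℝ g x‖ ^ 2 ∂(boltz V) := by
  have := isProbabilityMeasure_boltz hVint
  have hVc : Continuous (fderiv ℝ V) := hV.continuous_fderiv one_ne_zero
  have hwc : Continuous (radialWeight (n := n)) := (contDiff_radialWeight (k := 1)).continuous
  obtain ⟨R₀, hRR₀, hR₀⟩ : ∃ R₀ : ℝ, R ≤ R₀ ∧ 1 + 2 * n / c ≤ R₀ :=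
    ⟨max R (1 + 2 * n / c), le_max_left _ _, le_max_right _ _⟩
  have hn : (0 : ℝ) ≤ 2 * n / c := by positivity
  let B : Set (En n) := {x | ‖x‖ ≤ R₀}
  have hB : MeasurableSet B := measurableSet_le measurable_norm measurable_const
  obtain ⟨K, hK⟩ : ∃ K, ∀ x ∈ Metric.closedBall (0 : En n) R₀,
      ‖radialWeight x * (fderiv ℝ V x x - n)‖ ≤ K :=
    (isCompact_closedBall _ _).exists_bound_of_continuousOn (by fun_prop)
  have hK0 : 0 ≤ K := (norm_nonneg _).trans (hK 0 (by simp; linarith))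
  refine ⟨R₀, 4 / c * (K + c / 2), 4 / c * (4 / c), by linarith, by positivity, by positivity,
    fun g hg hgc => ?_⟩
  have hg0 := hg.continuous
  have hg' : Continuous (fderiv ℝ g) := hg.continuous_fderiv one_ne_zero
  have hgd : Differentiable ℝ g := hg.differentiable one_ne_zero
  have hgc2 : HasCompactSupport fun x => g x ^ 2 := hgc.comp_left (g := (· ^ 2)) (by simp)
  have hgc' : HasCompactSupport fun x => ‖fderiv ℝ g x‖ ^ 2 :=
    (hgc.fderiv (𝕜 := ℝ)).comp_left (g := (‖·‖ ^ 2)) (by simp)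
  have hw : ContDiff ℝ 1 fun x => radialWeight x * g x ^ 2 := contDiff_radialWeight.mul (hg.pow 2)
  have hwc' : HasCompactSupport fun x => radialWeight x * g x ^ 2 := hgc2.mul_left
  have hDw : Continuous (fderiv ℝ fun x => radialWeight x * g x ^ 2) :=
    hw.continuous_fderiv one_ne_zero
  have i1 : Integrable (fun x => g x ^ 2) (boltz V) :=
    Continuous.integrable_of_hasCompactSupport (by fun_prop) hgc2
  have i2 : Integrable (fun x => ‖fderiv ℝ g x‖ ^ 2) (boltz V) :=
    Continuous.integrable_of_hasCompactSupport (by fun_prop) hgc'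
  have i3 : Integrable (fun x => radialWeight x * g x ^ 2 * fderiv ℝ V x x) (boltz V) :=
    Continuous.integrable_of_hasCompactSupport (by fun_prop) hwc'.mul_right
  have i4 : Integrable (fun x => n * (radialWeight x * g x ^ 2)
      + fderiv ℝ (fun x => radialWeight x * g x ^ 2) x x) (boltz V) := by
    refine Continuous.integrable_of_hasCompactSupport (by fun_prop) (hwc'.mul_left.add ?_)
    exact (hwc'.fderiv (𝕜 := ℝ)).mono' fun x hx => subset_tsupport _ fun h0 => hx (by simp [h0])
  have i5 : Integrable (B.indicator fun x => g x ^ 2) (boltz V) := i1.indicator hB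
  have hdrift' (x : En n) : c / 2 * g x ^ 2 - (K + c / 2) * B.indicator (fun x => g x ^ 2) x
      ≤ radialWeight x * (fderiv ℝ V x x - n) * g x ^ 2 := by
    by_cases hx : x ∈ B
    · have h1 := (abs_le.1 (hK x (by simpa [B] using hx))).1
      rw [indicator_of_mem hx]
      nlinarith [mul_le_mul_of_nonneg_right h1 (sq_nonneg (g x))]
    · rw [indicator_of_notMem hx, mul_zero, sub_zero]
      have hx' : R₀ < ‖x‖ := not_le.1 hx
      refine mul_le_mul_of_nonneg_right ?_ (sq_nonneg _)
      have h1 := hdrift x (hRR₀.trans hx'.le)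
      have h2 : c / 2 * (1 + ‖x‖) ≤ fderiv ℝ V x x - n := by
        have h3 : c * (1 + 2 * n / c) ≤ c * ‖x‖ :=
          mul_le_mul_of_nonneg_left (hR₀.trans hx'.le) hc.le
        have h4 : c * (1 + 2 * n / c) = c + 2 * n := by field_simp
        linarith
      calc c / 2 ≤ c / 2 * (radialWeight x * (1 + ‖x‖)) :=
            le_mul_of_one_le_right (by positivity) (one_le_radialWeight_mul x)
        _ = radialWeight x * (c / 2 * (1 + ‖x‖)) := by ring
        _ ≤ _ := mul_le_mul_of_nonneg_left h2 (radialWeight_pos x).le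
  have key : ∫ x, (c / 4 * g x ^ 2 - 4 / c * ‖fderiv ℝ g x‖ ^ 2
      - (K + c / 2) * B.indicator (fun x => g x ^ 2) x) ∂(boltz V) ≤ 0 := by
    calc _ ≤ ∫ x, (radialWeight x * g x ^ 2 * fderiv ℝ V x x - (n * (radialWeight x * g x ^ 2)
            + fderiv ℝ (fun x => radialWeight x * g x ^ 2) x x)) ∂(boltz V) := by
          refine integral_mono (((i1.const_mul _).sub (i2.const_mul _)).sub (i5.const_mul _))
            (i3.sub i4) fun x => ?_
          have h1 := hdrift' x
          have h2 := fderiv_radialWeight_mul_sq_self_le (hgd x)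
          have h3 : 2 * (|g x| * ‖fderiv ℝ g x‖)
              ≤ c / 4 * g x ^ 2 + 4 / c * ‖fderiv ℝ g x‖ ^ 2 := by
            rw [← sq_abs (g x)]
            have h4 : 0 ≤ (c * |g x| - 4 * ‖fderiv ℝ g x‖) ^ 2 / (4 * c) := by positivity
            have h5 : (c * |g x| - 4 * ‖fderiv ℝ g x‖) ^ 2 / (4 * c) =
                c / 4 * |g x| ^ 2 + 4 / c * ‖fderiv ℝ g x‖ ^ 2
                  - 2 * (|g x| * ‖fderiv ℝ g x‖) := by
              field_simp
              ring
            linarith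
          simp only
          linarith
      _ = 0 := by
          rw [integral_sub i3 i4, integral_mul_fderiv_self_boltz hV hw hwc', sub_self]
  have i6 : Integrable (fun x => c / 4 * g x ^ 2 - 4 / c * ‖fderiv ℝ g x‖ ^ 2) (boltz V) :=
    (i1.const_mul _).sub (i2.const_mul _)
  rw [integral_sub i6 (i5.const_mul _), integral_sub (i1.const_mul _) (i2.const_mul _), integral_const_mul, integral_const_mul,
    integral_const_mul, integral_indicator hB] at key
  have h6 : ∫ x, g x ^ 2 ∂(boltz V) = 4 / c * (c / 4 * ∫ x, g x ^ 2 ∂(boltz V)) := by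
    field_simp
  rw [h6, mul_assoc, mul_assoc, ← mul_add]
  refine mul_le_mul_of_nonneg_left ?_ (by positivity)
  linarith

/-- Smooth cutoffs at scale `k` are eventually equal to one and have gradient of order `1 / k`. -/
theorem exists_seq_smooth_cutoff (n : ℕ) : ∃ (χ : ℕ → En n → ℝ) (G : ℝ), ∀ k : ℕ,
    ContDiff ℝ (⊤ : ℕ∞) (χ k) ∧ HasCompactSupport (χ k) ∧ (∀ x, χ k x ∈ Icc 0 1) ∧
      (∀ x, ‖x‖ ≤ k → χ k x = 1) ∧ ∀ x, ‖fderiv ℝ (χ k) x‖ ≤ ((k : ℝ) + 1)⁻¹ * G := by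
  let b : ContDiffBump (0 : En n) := ⟨1, 2, one_pos, one_lt_two⟩
  have hb : ContDiff ℝ (⊤ : ℕ∞) b := b.contDiff
  obtain ⟨G, hG⟩ := (b.hasCompactSupport.fderiv (𝕜 := ℝ)).exists_bound_of_continuous
    (hb.continuous_fderiv (by simp))
  refine ⟨fun k x => b (((k : ℝ) + 1)⁻¹ • x), G, fun k => ?_⟩
  have hk : (0 : ℝ) < (k : ℝ) + 1 := by positivity
  refine ⟨hb.comp (contDiff_const_smul _), b.hasCompactSupport.comp_smul (inv_ne_zero hk.ne'),
    fun x => ⟨b.nonneg, b.le_one⟩, fun x hx => b.one_of_mem_closedBall ?_, fun x => ?_⟩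
  · rw [mem_closedBall_zero_iff, norm_smul, norm_inv, Real.norm_of_nonneg hk.le,
      inv_mul_le_iff₀ hk]
    simp only [b]
    linarith
  · have h : fderiv ℝ (fun x => b (((k : ℝ) + 1)⁻¹ • x)) x = _ := fderiv_comp_smul _
    rw [h, norm_smul, norm_inv, Real.norm_of_nonneg hk.le]
    gcongr
    exact hG _

theorem integral_sub_const_sq {α : Type*} [MeasurableSpace α] {μ : Measure α}
    [IsFiniteMeasure μ] {f : α → ℝ} (hf : Integrable f μ)
    (hf2 : Integrable (fun x => f x ^ 2) μ) (m : ℝ) :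
    ∫ x, (f x - m) ^ 2 ∂μ = ∫ x, f x ^ 2 ∂μ - 2 * m * ∫ x, f x ∂μ + μ.real univ * m ^ 2 := by
  have h (x : α) : (f x - m) ^ 2 = f x ^ 2 - 2 * m * f x + m ^ 2 := by ring
  have h1 : Integrable (fun x => f x ^ 2 - 2 * m * f x) μ := hf2.sub (hf.const_mul _)
  simp only [h]
  rw [integral_add h1 (integrable_const _), integral_sub hf2 (hf.const_mul _),
    integral_const_mul, integral_const, smul_eq_mul]

theorem setIntegral_sub_average_sq {α : Type*} [MeasurableSpace α] {μ : Measure α}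
    [IsFiniteMeasure μ] {f : α → ℝ} {s : Set α} (hf : Integrable f μ)
    (hf2 : Integrable (fun x => f x ^ 2) μ) :
    ∫ x in s, (f x - (μ s).toReal⁻¹ * ∫ y in s, f y ∂μ) ^ 2 ∂μ
      = ∫ x in s, f x ^ 2 ∂μ - (μ s).toReal⁻¹ * (∫ x in s, f x ∂μ) ^ 2 := by
  have h : (μ s).toReal⁻¹ * (μ s).toReal⁻¹ * (μ s).toReal = (μ s).toReal⁻¹ := by
    by_cases h0 : (μ s).toReal = 0
    · simp [h0]
    · field_simp
  rw [integral_sub_const_sq hf.integrableOn hf2.integrableOn, measureReal_def,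
    Measure.restrict_apply_univ]
  linear_combination (∫ y in s, f y ∂μ) ^ 2 * h

theorem integral_sq_sub_sq_integral_le {α : Type*} [MeasurableSpace α] {μ : Measure α}
    [IsProbabilityMeasure μ] {f : α → ℝ} (hf : Integrable f μ)
    (hf2 : Integrable (fun x => f x ^ 2) μ) (m : ℝ) :
    ∫ x, f x ^ 2 ∂μ - (∫ x, f x ∂μ) ^ 2 ≤ ∫ x, (f x - m) ^ 2 ∂μ := by
  rw [integral_sub_const_sq hf hf2, probReal_univ]
  nlinarith [sq_nonneg ((∫ x, f x ∂μ) - m)]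

end

/-- if `x·∇V(x) ≥ c|x|` outside a ball and local Poincaré inequalities hold on
all balls, then `μ` satisfies a Poincaré inequality. -/
theorem stmt4 {n : ℕ} (hn : 0 < n) (V : En n → ℝ) (hV : ContDiff ℝ 2 V)
    (hVint : Integrable (fun x => Real.exp (-V x)))
    (c R : ℝ) (hc : 0 < c) (hR : 0 < R)
    (hdrift : ∀ x : En n, R ≤ ‖x‖ → c * ‖x‖ ≤ ⟪x, gradient V x⟫)
    (hloc : ∀ R' : ℝ, 0 < R' → ∃ κ : ℝ,
      ∀ f : En n → ℝ, ContDiff ℝ (⊤ : ℕ∞) f → HasCompactSupport f →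
        ∫ x in {x : En n | ‖x‖ ≤ R'}, (f x) ^ 2 ∂(boltz V)
          ≤ κ * ∫ x, ‖gradient f x‖ ^ 2 ∂(boltz V)
            + ((boltz V) {x : En n | ‖x‖ ≤ R'}).toReal⁻¹
                * (∫ x in {x : En n | ‖x‖ ≤ R'}, f x ∂(boltz V)) ^ 2) :
    ∃ C : ℝ, 0 < C ∧ ∀ f : En n → ℝ, ContDiff ℝ (⊤ : ℕ∞) f → HasCompactSupport f →
      ∫ x, (f x) ^ 2 ∂(boltz V) - (∫ x, f x ∂(boltz V)) ^ 2
        ≤ C * ∫ x, ‖gradient f x‖ ^ 2 ∂(boltz V) := by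
  have hμ := isProbabilityMeasure_boltz hVint
  simp only [norm_gradient] at hloc ⊢
  simp only [inner_self_gradient] at hdrift
  obtain ⟨R₀, A, D, hR₀, hA, hD, hAD⟩ :=
    exists_integral_sq_le_of_drift (hV.of_le (by norm_num)) hVint hc hdrift
  obtain ⟨κ, hκ⟩ := hloc R₀ hR₀
  obtain ⟨χ, G, hχ⟩ := exists_seq_smooth_cutoff n
  refine ⟨A * |κ| + 2 * D + 1, by positivity, fun f hf hfc => ?_⟩
  let B : Set (En n) := {x | ‖x‖ ≤ R₀}
  have hB : MeasurableSet B := measurableSet_le measurable_norm measurable_const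
  have hf0 := hf.continuous
  have hf' : Continuous (fderiv ℝ f) := hf.continuous_fderiv (by simp)
  have hfd : Differentiable ℝ f := hf.differentiable (by simp)
  have hf1 : Integrable f (boltz V) := hf0.integrable_of_hasCompactSupport hfc
  have hf2 : Integrable (fun x => f x ^ 2) (boltz V) :=
    Continuous.integrable_of_hasCompactSupport (by fun_prop)
      (hfc.comp_left (g := (· ^ 2)) (by simp))
  have hdf : Integrable (fun x => ‖fderiv ℝ f x‖ ^ 2) (boltz V) :=
    Continuous.integrable_of_hasCompactSupport (by fun_prop)
      ((hfc.fderiv (𝕜 := ℝ)).comp_left (g := (‖·‖ ^ 2)) (by simp))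
  set E := ∫ x, ‖fderiv ℝ f x‖ ^ 2 ∂(boltz V) with hE
  have hE0 : 0 ≤ E := integral_nonneg fun _ => by positivity
  set m := ((boltz V) B).toReal⁻¹ * ∫ x in B, f x ∂(boltz V) with hm
  have hBm : ∫ x in B, (f x - m) ^ 2 ∂(boltz V) ≤ |κ| * E := by
    rw [hm, setIntegral_sub_average_sq hf1 hf2]
    have h1 := hκ f hf hfc
    have h2 : κ * E ≤ |κ| * E := mul_le_mul_of_nonneg_right (le_abs_self κ) hE0
    simp only [B]
    linarith
  have hk (k : ℕ) (hkR : R₀ ≤ k) : ∫ x, (f x - m * χ k x) ^ 2 ∂(boltz V)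
      ≤ A * (|κ| * E) + D * (2 * E + 2 * (m * (((k : ℝ) + 1)⁻¹ * G)) ^ 2) := by
    obtain ⟨hs, hcs, -, h1, hG⟩ := hχ k
    have hgs : ContDiff ℝ 1 fun x => f x - m * χ k x :=
      (hf.sub (contDiff_const.mul hs)).of_le (by exact_mod_cast le_top)
    have hgc : HasCompactSupport fun x => f x - m * χ k x := hfc.sub hcs.mul_left
    have hg' : Continuous (fderiv ℝ fun x => f x - m * χ k x) :=
      hgs.continuous_fderiv one_ne_zero
    refine (hAD _ hgs hgc).trans (add_le_add (mul_le_mul_of_nonneg_left ?_ hA)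
      (mul_le_mul_of_nonneg_left ?_ hD))
    · refine le_trans (le_of_eq ?_) hBm
      refine setIntegral_congr_fun hB fun x hx => ?_
      simp only [h1 x (le_trans hx hkR), mul_one]
    · calc _ ≤ ∫ x, (2 * ‖fderiv ℝ f x‖ ^ 2 + 2 * (m * (((k : ℝ) + 1)⁻¹ * G)) ^ 2)
              ∂(boltz V) := by
            refine integral_mono (Continuous.integrable_of_hasCompactSupport (by fun_prop)
              ((hgc.fderiv (𝕜 := ℝ)).comp_left (g := (‖·‖ ^ 2)) (by simp)))
              ((hdf.const_mul _).add (integrable_const _)) fun x => ?_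
            have h2 : fderiv ℝ (fun x => f x - m * χ k x) x = fderiv ℝ f x - m • fderiv ℝ (χ k) x :=
              ((hfd x).hasFDerivAt.sub
                ((hs.differentiable (by simp) x).hasFDerivAt.const_mul m)).fderiv
            have h3 : ‖fderiv ℝ (fun x => f x - m * χ k x) x‖
                ≤ ‖fderiv ℝ f x‖ + |m| * (((k : ℝ) + 1)⁻¹ * G) := by
              rw [h2]
              refine (norm_sub_le _ _).trans (add_le_add le_rfl ?_)
              rw [norm_smul, Real.norm_eq_abs]
              exact mul_le_mul_of_nonneg_left (hG x) (abs_nonneg m)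
            calc _ ≤ (‖fderiv ℝ f x‖ + |m| * (((k : ℝ) + 1)⁻¹ * G)) ^ 2 := by
                  gcongr
              _ ≤ 2 * (‖fderiv ℝ f x‖ ^ 2 + (|m| * (((k : ℝ) + 1)⁻¹ * G)) ^ 2) := add_sq_le
              _ = _ := by
                  rw [mul_pow, sq_abs, ← mul_pow, mul_add]
        _ = _ := by
            rw [integral_add (hdf.const_mul _) (integrable_const _), integral_const_mul,
              integral_const, probReal_univ, one_smul]
  obtain ⟨M, hM⟩ := hfc.exists_bound_of_continuous hf0
  have hlim1 : Filter.Tendsto (fun k : ℕ => ∫ x, (f x - m * χ k x) ^ 2 ∂(boltz V)) Filter.atTop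
      (nhds (∫ x, (f x - m) ^ 2 ∂(boltz V))) := by
    refine tendsto_integral_of_dominated_convergence (fun _ => (M + |m|) ^ 2)
      (fun k => ?_) (integrable_const _) (fun k => Filter.Eventually.of_forall fun x => ?_)
      (Filter.Eventually.of_forall fun x => ?_)
    · have := (hχ k).1.continuous
      exact Continuous.aestronglyMeasurable (by fun_prop)
    · obtain ⟨-, -, h01, -, -⟩ := hχ k
      rw [norm_pow]
      gcongr
      refine (norm_sub_le _ _).trans (add_le_add (hM x) ?_)
      rw [norm_mul, Real.norm_eq_abs, Real.norm_of_nonneg (h01 x).1]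
      exact mul_le_of_le_one_right (abs_nonneg m) (h01 x).2
    · refine tendsto_const_nhds.congr' ?_
      filter_upwards [Filter.eventually_ge_atTop ⌈‖x‖⌉₊] with k hk
      rw [(hχ k).2.2.2.1 x (Nat.ceil_le.1 hk), mul_one]
  have hlim2 : Filter.Tendsto (fun k : ℕ =>
      A * (|κ| * E) + D * (2 * E + 2 * (m * (((k : ℝ) + 1)⁻¹ * G)) ^ 2)) Filter.atTop
      (nhds (A * (|κ| * E) + D * (2 * E + 2 * (m * (0 * G)) ^ 2))) := by
    have h0 : Filter.Tendsto (fun k : ℕ => ((k : ℝ) + 1)⁻¹) Filter.atTop (nhds 0) := by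
      simpa only [one_div] using tendsto_one_div_add_atTop_nhds_zero_nat (𝕜 := ℝ)
    exact tendsto_const_nhds.add (tendsto_const_nhds.mul (tendsto_const_nhds.add
      (tendsto_const_nhds.mul ((tendsto_const_nhds.mul (h0.mul_const G)).pow 2))))
  have hfin : ∫ x, (f x - m) ^ 2 ∂(boltz V)
      ≤ A * (|κ| * E) + D * (2 * E + 2 * (m * (0 * G)) ^ 2) := by
    refine le_of_tendsto_of_tendsto hlim1 hlim2 ?_
    filter_upwards [Filter.eventually_ge_atTop ⌈R₀⌉₊] with k hk'
    exact hk k (Nat.ceil_le.1 hk')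
  refine (integral_sq_sub_sq_integral_le hf1 hf2 m).trans (hfin.trans ?_)
  linarith
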